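/- For every n ≥ 0, the abelian complexity function ρ of the ordinary paperfolding word satisfies ρ(16n+11) = ρ(4n+3) + 2. -/

import Mathlib

/-- The ordinary paperfolding word over `{0,1}`, indexed from 1:
writing `n = n' * 2^k` with `n'` odd, `pf n = 0` if `n' ≡ 1 (mod 4)`
and `pf n = 1` if `n' ≡ 3 (mod 4)`.  (The value at `0` is irrelevant.) -/
def pf (n : ℕ) : ℕ := if (n / 2 ^ (n.factorization 2)) % 4 = 1 then 0 else 1

/-- The factor `f_i f_{i+1} ⋯ f_{i+n-1}` of the paperfolding word,
of length `n`, starting at position `i`. -/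
def pfFactor (i n : ℕ) : List ℕ := (List.range n).map (fun j => pf (i + j))

/-- `w` is a factor of the ordinary paperfolding word. -/
def IsPFFactor (w : List ℕ) : Prop := ∃ i : ℕ, 1 ≤ i ∧ w = pfFactor i w.length

/-- The abelian complexity function of the ordinary paperfolding word:
the number of abelian equivalence classes of factors of length `n`,
where the class of a factor `w` is determined by the pair
`(|w|_0, |w|_1)` of numbers of occurrences of `0` and `1` in `w`. -/
noncomputable def ρ (n : ℕ) : ℕ :=
  {p : ℕ × ℕ | ∃ i : ℕ, 1 ≤ i ∧
    p = ((pfFactor i n).count 0, (pfFactor i n).count 1)}.ncard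

/-- `Δ w = |w|_0 - |w|_1`. -/
def Δ (w : List ℕ) : ℤ := (w.count 0 : ℤ) - (w.count 1 : ℤ)

/-- `M n` is the maximum of `Δ w` over all factors `w` of the
paperfolding word of length `n`. -/
noncomputable def M (n : ℕ) : ℤ :=
  sSup {d : ℤ | ∃ i : ℕ, 1 ≤ i ∧ d = Δ (pfFactor i n)}

theorem pf_le_one (n : ℕ) : pf n ≤ 1 := by
  unfold pf; split <;> omega

theorem pf_two_mul {n : ℕ} (hn : n ≠ 0) : pf (2 * n) = pf n := by
  have h : (2 * n).factorization 2 = n.factorization 2 + 1 := by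
    rw [Nat.factorization_mul two_ne_zero hn, Finsupp.add_apply,
      Nat.Prime.factorization_self Nat.prime_two, add_comm]
  unfold pf
  rw [h, pow_succ', Nat.mul_div_mul_left _ _ two_pos]

theorem pf_of_odd {n : ℕ} (hn : n % 2 = 1) : pf n = if n % 4 = 1 then 0 else 1 := by
  unfold pf
  rw [Nat.factorization_eq_zero_of_not_dvd (by omega), pow_zero, Nat.div_one]

/-- The paperfolding word is locally periodic with period a large power of two. -/
theorem pf_two_pow_add (k : ℕ) : ∀ j, 1 ≤ j → j < 2 ^ k → pf (2 ^ (k + 1) + j) = pf j := by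
  induction k with
  | zero => intro j h1 h2; simp at h2; omega
  | succ k ih =>
    intro j h1 h2
    have e1 : 2 ^ (k + 1) = 2 * 2 ^ k := pow_succ' 2 k
    have e2 : 2 ^ (k + 1 + 1) = 2 * 2 ^ (k + 1) := pow_succ' 2 (k + 1)
    rcases Nat.even_or_odd' j with ⟨i, rfl | rfl⟩
    · rw [e2, ← mul_add, pf_two_mul (by omega), pf_two_mul (by omega)]
      exact ih i (by omega) (by omega)
    · rw [pf_of_odd (by omega), pf_of_odd (by omega),
        show (2 ^ (k + 1 + 1) + (2 * i + 1)) % 4 = (2 * i + 1) % 4 by omega]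

/-- The paperfolding word is antisymmetric about a large power of two. -/
theorem pf_two_pow_sub (k : ℕ) :
    ∀ j, 1 ≤ j → j < 2 ^ k → pf (2 ^ (k + 1) - j) + pf j = 1 := by
  induction k with
  | zero => intro j h1 h2; simp at h2; omega
  | succ k ih =>
    intro j h1 h2
    have e1 : 2 ^ (k + 1) = 2 * 2 ^ k := pow_succ' 2 k
    have e2 : 2 ^ (k + 1 + 1) = 2 * 2 ^ (k + 1) := pow_succ' 2 (k + 1)
    rcases Nat.even_or_odd' j with ⟨i, rfl | rfl⟩
    · rw [e2, ← Nat.mul_sub, pf_two_mul (by omega), pf_two_mul (by omega)]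
      exact ih i (by omega) (by omega)
    · rw [pf_of_odd (by omega), pf_of_odd (by omega)]
      split <;> split <;> omega

/-- The number of zeros minus the number of ones among the first `k` letters. -/
def pfPrefix (k : ℕ) : ℤ := ∑ j ∈ Finset.range k, (1 - 2 * (pf (j + 1) : ℤ))

theorem pfPrefix_succ (k : ℕ) : pfPrefix (k + 1) = pfPrefix k + (1 - 2 * (pf (k + 1) : ℤ)) :=
  Finset.sum_range_succ _ _

theorem pfPrefix_four_mul_add_one (k : ℕ) : pfPrefix (4 * k + 1) = pfPrefix (4 * k) + 1 := by
  rw [pfPrefix_succ, pf_of_odd (by omega), if_pos (by omega)]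
  simp

theorem pfPrefix_four_mul_add_two (k : ℕ) :
    pfPrefix (4 * k + 2) = pfPrefix (4 * k) + 2 - 2 * ((k % 2 : ℕ) : ℤ) := by
  rw [pfPrefix_succ, pfPrefix_four_mul_add_one, show 4 * k + 1 + 1 = 2 * (2 * k + 1) by ring,
    pf_two_mul (by omega), pf_of_odd (by omega)]
  split <;> push_cast <;> omega

theorem pfPrefix_four_mul_add_three (k : ℕ) :
    pfPrefix (4 * k + 3) = pfPrefix (4 * k) + 1 - 2 * ((k % 2 : ℕ) : ℤ) := by
  rw [pfPrefix_succ, pfPrefix_four_mul_add_two, pf_of_odd (by omega), if_neg (by omega)]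
  push_cast
  ring

theorem pfPrefix_four_mul (k : ℕ) : pfPrefix (4 * k) = pfPrefix k + ((k % 2 : ℕ) : ℤ) := by
  induction k with
  | zero => simp
  | succ k ih =>
    rw [show 4 * (k + 1) = 4 * k + 3 + 1 by ring, pfPrefix_succ (4 * k + 3),
      pfPrefix_four_mul_add_three, ih, pfPrefix_succ k,
      show 4 * k + 3 + 1 = 2 * (2 * (k + 1)) by ring, pf_two_mul (by omega),
      pf_two_mul (by omega)]
    omega

theorem pfPrefix_two_pow_add (k a : ℕ) (ha : a < 2 ^ k) :
    pfPrefix (2 ^ (k + 1) + a) = pfPrefix (2 ^ (k + 1)) + pfPrefix a := by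
  induction a with
  | zero => simp [pfPrefix]
  | succ a ih =>
    rw [← add_assoc, pfPrefix_succ, pfPrefix_succ a, ih (by omega), add_assoc (2 ^ (k + 1)) a 1,
      pf_two_pow_add k (a + 1) (by omega) ha, add_assoc]

theorem pfPrefix_two_pow_sub (k a : ℕ) (ha : a < 2 ^ k) :
    pfPrefix (2 ^ (k + 1) - 1 - a) = pfPrefix (2 ^ (k + 1) - 1) + pfPrefix a := by
  induction a with
  | zero => simp [pfPrefix]
  | succ a ih =>
    have e1 : 2 ^ (k + 1) = 2 * 2 ^ k := pow_succ' 2 k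
    have h := pf_two_pow_sub k (a + 1) (by omega) ha
    have h1 := pfPrefix_succ (2 ^ (k + 1) - 1 - (a + 1))
    rw [show 2 ^ (k + 1) - 1 - (a + 1) + 1 = 2 ^ (k + 1) - 1 - a by omega, ih (by omega),
      show 2 ^ (k + 1) - 1 - a = 2 ^ (k + 1) - (a + 1) by omega] at h1
    have h2 := pfPrefix_succ a
    omega

/-- The number of zeros minus the number of ones in the factor of length `N` preceded by exactly
`a` letters. -/
def pfWindow (a N : ℕ) : ℤ := pfPrefix (a + N) - pfPrefix a

theorem two_mul_count_zero_pfFactor (a N : ℕ) :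
    2 * ((pfFactor (a + 1) N).count 0 : ℤ) = N + pfWindow a N := by
  induction N with
  | zero => simp [pfFactor, pfWindow]
  | succ N ih =>
    have h := pfPrefix_succ (a + N)
    have h1 := pf_le_one (a + N + 1)
    have e : a + 1 + N = a + N + 1 := by ring
    simp only [pfFactor, pfWindow, List.range_succ, List.map_append, List.map_cons, List.map_nil,
      List.count_append, List.count_singleton, e, beq_iff_eq, ← add_assoc] at ih ⊢
    split <;> push_cast <;> omega

theorem count_zero_add_count_one_pfFactor (i N : ℕ) :
    (pfFactor i N).count 0 + (pfFactor i N).count 1 = N := by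
  induction N with
  | zero => simp [pfFactor]
  | succ N ih =>
    have h1 := pf_le_one (i + N)
    simp only [pfFactor, List.range_succ, List.map_append, List.map_cons, List.map_nil,
      List.count_append, List.count_singleton, beq_iff_eq] at ih ⊢
    split <;> split <;> omega

theorem exists_pfWindow_eq_neg (a N : ℕ) : ∃ b, pfWindow b N = -pfWindow a N := by
  have hlt : a + N < 2 ^ (a + N) := Nat.lt_two_pow_self
  have e : 2 ^ (a + N + 1) = 2 * 2 ^ (a + N) := pow_succ' 2 (a + N)
  refine ⟨2 ^ (a + N + 1) - 1 - (a + N), ?_⟩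
  unfold pfWindow
  rw [show 2 ^ (a + N + 1) - 1 - (a + N) + N = 2 ^ (a + N + 1) - 1 - a by omega,
    pfPrefix_two_pow_sub _ _ hlt, pfPrefix_two_pow_sub _ _ (by omega)]
  ring

/-- A discrete intermediate value theorem. -/
theorem exists_eq_of_abs_sub_le_one {f : ℕ → ℤ} (hf : ∀ i, |f (i + 1) - f i| ≤ 1) {a b : ℕ}
    {v : ℤ} (ha : f a ≤ v) (hb : v ≤ f b) : ∃ c, f c = v := by
  by_contra! hne
  have above : ∀ i, v < f i ↔ v < f 0 := by
    intro i
    induction i with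
    | zero => rfl
    | succ i ih =>
      have h1 := abs_le.1 (hf i)
      have h2 := hne i
      have h3 := hne (i + 1)
      rw [← ih]
      omega
  have h1 := above a
  have h2 := above b
  have h3 := hne b
  omega

theorem abs_count_zero_pfFactor_succ_sub_le_one (N a : ℕ) :
    |((pfFactor (a + 1 + 1) N).count 0 : ℤ) - (pfFactor (a + 1) N).count 0| ≤ 1 := by
  have h1 := two_mul_count_zero_pfFactor a N
  have h2 := two_mul_count_zero_pfFactor (a + 1) N
  have h3 := pfPrefix_succ (a + N)
  have h4 := pfPrefix_succ a
  have h5 := pf_le_one (a + N + 1)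
  have h6 := pf_le_one (a + 1)
  unfold pfWindow at h1 h2
  rw [show a + 1 + N = a + N + 1 by ring] at h2
  rw [abs_le]
  omega

/-- The abelian complexity is one more than the largest excess of zeros over ones. -/
theorem rho_eq_of_isGreatest {N : ℕ} {m : ℤ} (hm : IsGreatest (Set.range (pfWindow · N)) m) :
    (ρ N : ℤ) = m + 1 := by
  obtain ⟨⟨a, ha⟩, hle⟩ := hm
  replace hle : ∀ c, pfWindow c N ≤ m := fun c => hle ⟨c, rfl⟩
  obtain ⟨b, hb⟩ := exists_pfWindow_eq_neg a N
  have count_eq := fun c => two_mul_count_zero_pfFactor c N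
  have hset : {p : ℕ × ℕ | ∃ i : ℕ, 1 ≤ i ∧
      p = ((pfFactor i N).count 0, (pfFactor i N).count 1)} =
      (fun k => (k, N - k)) '' (Finset.Icc ((pfFactor (b + 1) N).count 0)
        ((pfFactor (a + 1) N).count 0) : Set ℕ) := by
    ext ⟨x, y⟩
    simp only [Set.mem_ofPred_eq, Set.mem_image, Finset.coe_Icc, Set.mem_Icc, Prod.mk.injEq]
    constructor
    · rintro ⟨i, hi, rfl, rfl⟩
      obtain ⟨c, rfl⟩ := Nat.exists_eq_add_of_le' hi
      obtain ⟨d, hd⟩ := exists_pfWindow_eq_neg c N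
      have h1 := hle c
      have h2 := hle d
      have h3 := count_eq a
      have h4 := count_eq b
      have h5 := count_eq c
      have h6 := count_zero_add_count_one_pfFactor (c + 1) N
      refine ⟨_, ⟨?_, ?_⟩, rfl, ?_⟩ <;> dsimp only at * <;> omega
    · rintro ⟨k, ⟨h1, h2⟩, rfl, rfl⟩
      obtain ⟨c, hc⟩ := exists_eq_of_abs_sub_le_one
        (f := fun i => ((pfFactor (i + 1) N).count 0 : ℤ))
        (abs_count_zero_pfFactor_succ_sub_le_one N) (v := (k : ℤ))
        (Int.ofNat_le.2 h1) (Int.ofNat_le.2 h2)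
      have h6 := count_zero_add_count_one_pfFactor (c + 1) N
      refine ⟨c + 1, by omega, ?_, ?_⟩ <;> dsimp only at * <;> omega
  have hinj : Function.Injective (fun k : ℕ => (k, N - k)) := fun x y h => (Prod.ext_iff.1 h).1
  unfold ρ
  rw [hset, Set.ncard_image_of_injective _ hinj, Set.ncard_coe_finset, Nat.card_Icc]
  have h3 := count_eq a
  have h4 := count_eq b
  have h5 := hle b
  dsimp only at *
  omega

theorem exists_isGreatest_pfWindow (N : ℕ) : ∃ m, IsGreatest (Set.range (pfWindow · N)) m := by
  obtain ⟨m, hm, hle⟩ := Int.exists_greatest_of_bdd (P := (· ∈ Set.range (pfWindow · N)))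
    ⟨N, by
      rintro _ ⟨a, rfl⟩
      have h1 := two_mul_count_zero_pfFactor a N
      have h2 := count_zero_add_count_one_pfFactor (a + 1) N
      dsimp only
      omega⟩ ⟨_, ⟨0, rfl⟩⟩
  exact ⟨m, hm, hle⟩

/-- Every factor of length `4 * n + 3` is dominated by one preceded by an odd number of letters. -/
theorem exists_odd_pfWindow_ge (n a : ℕ) :
    ∃ b, b % 2 = 1 ∧ pfWindow a (4 * n + 3) ≤ pfWindow b (4 * n + 3) := by
  have pos : ∀ c, ∃ b, b % 2 = 1 ∧ pfWindow (4 * (c + 1)) (4 * n + 3) ≤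
      pfWindow b (4 * n + 3) := by
    intro c
    refine ⟨4 * c + 3, by omega, ?_⟩
    have h1 := pfPrefix_succ (4 * c + 3)
    have h2 := pf_le_one (4 * c + 3 + 1)
    have h3 := pfPrefix_four_mul_add_three (c + 1 + n)
    have h4 := pfPrefix_four_mul_add_two (c + 1 + n)
    unfold pfWindow
    rw [show 4 * (c + 1) + (4 * n + 3) = 4 * (c + 1 + n) + 3 by ring,
      show 4 * c + 3 + (4 * n + 3) = 4 * (c + 1 + n) + 2 by ring,
      show 4 * (c + 1) = 4 * c + 3 + 1 by ring]
    omega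
  obtain ⟨c, r, hr, rfl⟩ : ∃ c r, r < 4 ∧ a = 4 * c + r :=
    ⟨a / 4, a % 4, by omega, by omega⟩
  interval_cases r
  · rcases c with _ | c
    · have hlt : 4 * n + 3 < 2 ^ (4 * n + 3) := Nat.lt_two_pow_self
      have h := pfPrefix_two_pow_add _ _ hlt
      obtain ⟨b, hb, hle⟩ := pos (2 ^ (4 * n + 2) - 1)
      refine ⟨b, hb, le_trans (le_of_eq ?_) hle⟩
      have e : 4 * (2 ^ (4 * n + 2) - 1 + 1) = 2 ^ (4 * n + 3 + 1) := by
        rw [Nat.sub_add_cancel Nat.one_le_two_pow]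
        ring
      unfold pfWindow
      rw [e, h]
      simp [pfPrefix]
    · exact pos c
  · exact ⟨_, by omega, le_rfl⟩
  · refine ⟨4 * c + 3, by omega, ?_⟩
    have h1 := pfPrefix_four_mul_add_two c
    have h2 := pfPrefix_four_mul_add_three c
    have h3 := pfPrefix_four_mul_add_one (c + n + 1)
    have h4 := pfPrefix_four_mul_add_two (c + n + 1)
    unfold pfWindow
    rw [show 4 * c + 2 + (4 * n + 3) = 4 * (c + n + 1) + 1 by ring,
      show 4 * c + 3 + (4 * n + 3) = 4 * (c + n + 1) + 2 by ring]
    omega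
  · exact ⟨_, by omega, le_rfl⟩

theorem pfWindow_sixteen_mul_add_eleven_le (n a : ℕ) :
    ∃ b, pfWindow a (16 * n + 11) ≤ pfWindow b (4 * n + 3) + 2 := by
  obtain ⟨c, r, hr, rfl⟩ : ∃ c r, r < 4 ∧ a = 4 * c + r :=
    ⟨a / 4, a % 4, by omega, by omega⟩
  refine ⟨c, ?_⟩
  have h0 := pfPrefix_four_mul c
  have h1 := pfPrefix_four_mul_add_one c
  have h2 := pfPrefix_four_mul_add_two c
  have h3 := pfPrefix_four_mul_add_three c
  have g0 := pfPrefix_four_mul (c + (4 * n + 3))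
  have g1 := pfPrefix_four_mul_add_one (c + (4 * n + 3))
  have g2 := pfPrefix_four_mul_add_two (c + (4 * n + 3))
  have k0 := pfPrefix_four_mul (c + (4 * n + 2))
  have k3 := pfPrefix_four_mul_add_three (c + (4 * n + 2))
  have k := pfPrefix_succ (c + (4 * n + 2))
  have hpf := pf_le_one (c + (4 * n + 2) + 1)
  rw [show c + (4 * n + 2) + 1 = c + (4 * n + 3) by ring] at k hpf
  unfold pfWindow
  interval_cases r
  · rw [show 4 * c + 0 + (16 * n + 11) = 4 * (c + (4 * n + 2)) + 3 by ring, add_zero]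
    omega
  · rw [show 4 * c + 1 + (16 * n + 11) = 4 * (c + (4 * n + 3)) by ring]
    omega
  · rw [show 4 * c + 2 + (16 * n + 11) = 4 * (c + (4 * n + 3)) + 1 by ring]
    omega
  · rw [show 4 * c + 3 + (16 * n + 11) = 4 * (c + (4 * n + 3)) + 2 by ring]
    omega

theorem pfWindow_four_mul_add_three_of_odd (n : ℕ) {b : ℕ} (hb : b % 2 = 1) :
    pfWindow (4 * b + 3) (16 * n + 11) = pfWindow b (4 * n + 3) + 2 := by
  have h0 := pfPrefix_four_mul b
  have h3 := pfPrefix_four_mul_add_three b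
  have g0 := pfPrefix_four_mul (b + (4 * n + 3))
  have g2 := pfPrefix_four_mul_add_two (b + (4 * n + 3))
  unfold pfWindow
  rw [show 4 * b + 3 + (16 * n + 11) = 4 * (b + (4 * n + 3)) + 2 by ring]
  omega

theorem pf_rho_sixteen_mul_add_eleven : ∀ n : ℕ, ρ (16 * n + 11) = ρ (4 * n + 3) + 2 := by
  intro n
  obtain ⟨m, hm⟩ := exists_isGreatest_pfWindow (4 * n + 3)
  have hm' : IsGreatest (Set.range (pfWindow · (16 * n + 11))) (m + 2) := by
    constructor
    · obtain ⟨a, ha⟩ := hm.1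
      obtain ⟨b, hb, hab⟩ := exists_odd_pfWindow_ge n a
      have hbm : pfWindow b (4 * n + 3) ≤ m := hm.2 ⟨b, rfl⟩
      refine ⟨4 * b + 3, ?_⟩
      have h := pfWindow_four_mul_add_three_of_odd n hb
      dsimp only at *
      omega
    · rintro _ ⟨a, rfl⟩
      obtain ⟨b, hb⟩ := pfWindow_sixteen_mul_add_eleven_le n a
      have hbm : pfWindow b (4 * n + 3) ≤ m := hm.2 ⟨b, rfl⟩
      dsimp only
      omega
  have h1 := rho_eq_of_isGreatest hm
  have h2 := rho_eq_of_isGreatest hm'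
  omega
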